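/- Fix an integer d ≥ 2. The function G_1 is differentiable on (0,∞) and satisfies the Riccati differential equation G_1′(z) = −1 − ((d+2)/z)·G_1(z) + G_1(z)² for every z > 0. -/

import Mathlib

open MeasureTheory Real Filter

/-- The modified Bessel function of the second kind, defined via its integral
representation `K_ν(z) = ∫_0^∞ exp(−z cosh t) cosh(ν t) dt`. -/
noncomputable def besselK (ν z : ℝ) : ℝ :=
  ∫ t in Set.Ioi (0:ℝ), Real.exp (-z * Real.cosh t) * Real.cosh (ν * t)

/-- The ratio `G_k(z) = K_{(d+1)/2+k}(z) / K_{(d+1)/2}(z)`. -/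
noncomputable def G (d k : ℤ) (z : ℝ) : ℝ :=
  besselK (((d : ℝ) + 1) / 2 + (k : ℝ)) z / besselK (((d : ℝ) + 1) / 2) z

/-- The Gaussian majorant of the integrand of `besselK`. -/
theorem exp_neg_mul_cosh_mul_cosh_le (ν : ℝ) {z : ℝ} (hz : 0 < z) {t : ℝ} (ht : 0 ≤ t) :
    exp (-z * cosh t) * cosh (ν * t) ≤ exp (2 * ν ^ 2 / z) * exp (-(z / 8) * t ^ 2) := by
  have hcosh : t ^ 2 / 4 ≤ cosh t := by
    have h := quadratic_le_exp_of_nonneg ht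
    have h' := exp_pos (-t)
    rw [cosh_eq]
    linarith
  have habs : |ν * t| ≤ 2 * ν ^ 2 / z + z / 8 * t ^ 2 := by
    have h : 2 * ν ^ 2 / z + z / 8 * t ^ 2 - |ν| * t = 2 / z * (|ν| - z * t / 4) ^ 2 := by
      rw [← sq_abs ν]
      field_simp
      ring
    have h' : 0 ≤ 2 / z * (|ν| - z * t / 4) ^ 2 := by positivity
    rw [abs_mul, abs_of_nonneg ht]
    linarith
  have hle : cosh (ν * t) ≤ exp |ν * t| := by
    rw [← cosh_abs, cosh_eq]
    have h : exp (-|ν * t|) ≤ exp |ν * t| :=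
      exp_le_exp.mpr (by linarith [abs_nonneg (ν * t)])
    linarith
  calc exp (-z * cosh t) * cosh (ν * t) ≤ exp (-z * cosh t) * exp |ν * t| := by gcongr
    _ = exp (-z * cosh t + |ν * t|) := (exp_add _ _).symm
    _ ≤ exp (2 * ν ^ 2 / z + -(z / 8) * t ^ 2) := by
      refine exp_le_exp.mpr ?_
      nlinarith [mul_le_mul_of_nonneg_left hcosh hz.le]
    _ = _ := exp_add _ _

theorem integrableOn_exp_neg_mul_cosh_mul_cosh (ν : ℝ) {z : ℝ} (hz : 0 < z) :
    IntegrableOn (fun t => exp (-z * cosh t) * cosh (ν * t)) (Set.Ioi 0) := by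
  have hg : Integrable (fun t : ℝ => exp (2 * ν ^ 2 / z) * exp (-(z / 8) * t ^ 2)) :=
    (integrable_exp_neg_mul_sq (by positivity)).const_mul _
  refine hg.integrableOn.mono' (by fun_prop) ?_
  filter_upwards [ae_restrict_mem measurableSet_Ioi] with t ht
  rw [norm_of_nonneg (mul_pos (exp_pos _) (cosh_pos _)).le]
  exact exp_neg_mul_cosh_mul_cosh_le ν hz (le_of_lt ht)

theorem integrableOn_exp_neg_mul_cosh_mul_sinh (ν : ℝ) {z : ℝ} (hz : 0 < z) :
    IntegrableOn (fun t => exp (-z * cosh t) * sinh (ν * t)) (Set.Ioi 0) := by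
  refine (integrableOn_exp_neg_mul_cosh_mul_cosh ν hz).mono' (by fun_prop) ?_
  refine Eventually.of_forall fun t => ?_
  rw [norm_mul, norm_of_nonneg (exp_pos _).le, norm_eq_abs]
  gcongr
  exact abs_le.mpr ⟨by linarith [exp_pos (ν * t), cosh_add_sinh (ν * t)],
    (sinh_lt_cosh _).le⟩

theorem besselK_pos (ν : ℝ) {z : ℝ} (hz : 0 < z) : 0 < besselK ν z := by
  have hpos : ∀ t, 0 < exp (-z * cosh t) * cosh (ν * t) :=
    fun t => mul_pos (exp_pos _) (cosh_pos _)
  rw [besselK, setIntegral_pos_iff_support_of_nonneg_ae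
    (Eventually.of_forall fun t => (hpos t).le) (integrableOn_exp_neg_mul_cosh_mul_cosh ν hz)]
  have hsupp : Function.support (fun t => exp (-z * cosh t) * cosh (ν * t)) = Set.univ :=
    Set.eq_univ_of_forall fun t => (hpos t).ne'
  rw [hsupp]
  simp

/-- The recurrence `K_{ν+1}(z) − K_{ν−1}(z) = (2ν/z) K_ν(z)`. -/
theorem besselK_add_one_sub_besselK_sub_one (ν : ℝ) {z : ℝ} (hz : 0 < z) :
    besselK (ν + 1) z - besselK (ν - 1) z = 2 * ν / z * besselK ν z := by
  have hp := integrableOn_exp_neg_mul_cosh_mul_cosh (ν + 1) hz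
  have hm := integrableOn_exp_neg_mul_cosh_mul_cosh (ν - 1) hz
  have hν := integrableOn_exp_neg_mul_cosh_mul_cosh ν hz
  have hpm : IntegrableOn (fun t => z / 2 * (exp (-z * cosh t) * cosh ((ν + 1) * t)
      - exp (-z * cosh t) * cosh ((ν - 1) * t))) (Set.Ioi 0) :=
    (hp.sub hm).const_mul (z / 2)
  have hderiv : ∀ t ∈ Set.Ici (0 : ℝ), HasDerivAt (fun t => exp (-z * cosh t) * sinh (ν * t))
      (ν * (exp (-z * cosh t) * cosh (ν * t)) - z / 2 * (exp (-z * cosh t) * cosh ((ν + 1) * t)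
        - exp (-z * cosh t) * cosh ((ν - 1) * t))) t := by
    intro t _
    have h := (((hasDerivAt_cosh t).const_mul (-z)).exp).mul
      (((hasDerivAt_id t).const_mul ν).sinh)
    refine h.congr_deriv ?_
    rw [add_mul, sub_mul, one_mul, cosh_add, cosh_sub]
    simp only [id]
    ring
  have hint : IntegrableOn (fun t => ν * (exp (-z * cosh t) * cosh (ν * t)) - z / 2 *
      (exp (-z * cosh t) * cosh ((ν + 1) * t) - exp (-z * cosh t) * cosh ((ν - 1) * t)))
      (Set.Ioi 0) :=
    (hν.const_mul ν).sub hpm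
  have hlim := tendsto_zero_of_hasDerivAt_of_integrableOn_Ioi
    (fun t ht => hderiv t (Set.Ioi_subset_Ici_self ht)) hint
    (integrableOn_exp_neg_mul_cosh_mul_sinh ν hz)
  have h := integral_Ioi_of_hasDerivAt_of_tendsto' hderiv hint hlim
  rw [integral_sub (hν.const_mul ν) hpm, integral_const_mul,
    integral_const_mul, integral_sub hp hm] at h
  simp only [mul_zero, sinh_zero, sub_zero] at h
  rw [← besselK, ← besselK, ← besselK] at h
  field_simp
  linarith

/-- The derivative formula `K_ν′(z) = −(K_{ν+1}(z) + K_{ν−1}(z))/2`. -/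
theorem hasDerivAt_besselK (ν : ℝ) {z : ℝ} (hz : 0 < z) :
    HasDerivAt (besselK ν) (-(besselK (ν + 1) z + besselK (ν - 1) z) / 2) z := by
  have hcosh : ∀ x t : ℝ, cosh t * (exp (-x * cosh t) * cosh (ν * t)) =
      (exp (-x * cosh t) * cosh ((ν + 1) * t) + exp (-x * cosh t) * cosh ((ν - 1) * t)) / 2 := by
    intro x t
    rw [add_mul, sub_mul, one_mul, cosh_add, cosh_sub]
    ring
  have hint : ∀ x : ℝ, 0 < x →
      IntegrableOn (fun t => cosh t * (exp (-x * cosh t) * cosh (ν * t))) (Set.Ioi 0) := by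
    intro x hx
    simp only [hcosh]
    exact ((integrableOn_exp_neg_mul_cosh_mul_cosh (ν + 1) hx).add
      (integrableOn_exp_neg_mul_cosh_mul_cosh (ν - 1) hx)).div_const 2
  have h := (hasDerivAt_integral_of_dominated_loc_of_deriv_le
    (μ := volume.restrict (Set.Ioi (0 : ℝ)))
    (F := fun x t => exp (-x * cosh t) * cosh (ν * t))
    (F' := fun x t => -(cosh t * (exp (-x * cosh t) * cosh (ν * t))))
    (bound := fun t => cosh t * (exp (-(z / 2) * cosh t) * cosh (ν * t)))
    (Ioi_mem_nhds (half_lt_self hz))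
    (Eventually.of_forall fun x => by fun_prop)
    (integrableOn_exp_neg_mul_cosh_mul_cosh ν hz) (by fun_prop)
    (Eventually.of_forall fun t x hx => ?_) (hint _ (by positivity))
    (Eventually.of_forall fun t x _ => ?_)).2
  · refine h.congr_deriv ?_
    rw [integral_neg]
    simp only [hcosh]
    rw [integral_div, integral_add (integrableOn_exp_neg_mul_cosh_mul_cosh (ν + 1) hz)
      (integrableOn_exp_neg_mul_cosh_mul_cosh (ν - 1) hz)]
    simp only [besselK]
    ring
  · have hc := cosh_pos t
    have hc' := cosh_pos (ν * t)
    rw [norm_neg, norm_of_nonneg (by positivity)]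
    have hx' : z / 2 ≤ x := le_of_lt hx
    gcongr
  · have h := (((hasDerivAt_id x).neg.mul_const (cosh t)).exp).mul_const (cosh (ν * t))
    refine h.congr_deriv ?_
    simp only [id, Pi.neg_apply]
    ring

/-- `G_1` is differentiable on `(0,∞)` and satisfies the Riccati equation
`G_1′(z) = −1 − ((d+2)/z) G_1(z) + G_1(z)²`. -/
theorem G_one_riccati (d : ℤ) (hd : 2 ≤ d) (z : ℝ) (hz : 0 < z) :
    HasDerivAt (G d 1)
      (-1 - (((d : ℝ) + 2) / z) * G d 1 z + (G d 1 z) ^ 2) z := by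
  set μ : ℝ := ((d : ℝ) + 1) / 2 with hμ
  have hμ' : (d : ℝ) + 2 = 2 * μ + 1 := by rw [hμ]; ring
  have hpos := besselK_pos μ hz
  have hG : G d 1 = fun x => besselK (μ + 1) x / besselK μ x := by
    funext x
    simp [G, hμ]
  have hrec := besselK_add_one_sub_besselK_sub_one μ hz
  have hrec' := besselK_add_one_sub_besselK_sub_one (μ + 1) hz
  have hnum := hasDerivAt_besselK (μ + 1) hz
  rw [add_sub_cancel_right] at hrec' hnum
  rw [hG, hμ']
  refine (hnum.div (hasDerivAt_besselK μ hz) hpos.ne').congr_deriv ?_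
  rw [eq_add_of_sub_eq hrec', ← sub_eq_iff_eq_add'.mpr (sub_eq_iff_eq_add.mp hrec)]
  field_simp
  ring
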